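/- Run HPMD with η_k = k + k₀ and τ_k = 1/(k+k₀)², where k₀ = ⌈γ/(1−γ)⌉, and assume |c(s,a)| ≤ C for all (s,a). Then for every k ≥ K₁ := (K̲₁ + 2k₀)³, where K̲₁ = (32·ϱ·log|A|/(Δ*(M)·(1−γ)))·log(32·ϱ·log|A|/(Δ*(M)·(1−γ))): dist_{ℓ1}(π_{k+1}, Π*) ≤ 2·C_γ·|A|·exp( −Δ*(M)·k²/16 ) with C_γ = exp( C/(3(1−γ)) ), and moreover V^{π_{k+1}}(s) − V*(s) ≤ (2·C·|A|·C_γ/(1−γ)²)·exp( −Δ*(M)·k²/16 ) for every s ∈ S. -/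

import Mathlib

/-- A probability distribution on a finite set: nonnegative and sums to 1. -/
def IsDist {A : Type*} [Fintype A] (p : A → ℝ) : Prop :=
  (∀ a, 0 ≤ p a) ∧ ∑ a, p a = 1

/-- A (randomized, stationary) policy. -/
def IsPolicy {S A : Type*} [Fintype A] (π : S → A → ℝ) : Prop :=
  ∀ s, IsDist (π s)

/-- Kullback–Leibler divergence on a finite set (0·log 0 = 0). -/
noncomputable def KL {A : Type*} [Fintype A] (p q : A → ℝ) : ℝ :=
  ∑ a, p a * Real.log (p a / q a)

/-- The Q-function induced by a value function `V`. -/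
noncomputable def Qf {S A : Type*} [Fintype S] (γ : ℝ) (c : S → A → ℝ)
    (P : S → A → S → ℝ) (V : S → ℝ) (s : S) (a : A) : ℝ :=
  c s a + γ * ∑ s', P s a s' * V s'

/-- Minimal Q-value at a state. -/
noncomputable def Qmin {S A : Type*} [Fintype A] [Nonempty A] (Q : S → A → ℝ) (s : S) : ℝ :=
  Finset.univ.inf' Finset.univ_nonempty (Q s)

/-- Optimality of a policy, relative to the value function `V`. -/
def IsOptPolicy {S A : Type*} [Fintype A] (V : (S → A → ℝ) → S → ℝ) (π : S → A → ℝ) : Prop :=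
  IsPolicy π ∧ ∀ π', IsPolicy π' → ∀ s, V π s ≤ V π' s

/-- The ℓ₁ distance of a policy to the set of optimal policies. -/
noncomputable def distL1 {S A : Type*} [Fintype S] [Nonempty S] [Fintype A]
    (V : (S → A → ℝ) → S → ℝ) (π : S → A → ℝ) : ℝ :=
  Finset.univ.sup' Finset.univ_nonempty
    (fun s => sInf {x : ℝ | ∃ π', IsOptPolicy V π' ∧ x = ∑ a, |π s a - π' s a|})

section Divergence

open Finset

variable {A : Type*} [Fintype A]

theorem IsDist.sum_mul_le {p f : A → ℝ} {M : ℝ} (hp : IsDist p) (hf : ∀ a, f a ≤ M) :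
    ∑ a, p a * f a ≤ M := by
  calc ∑ a, p a * f a ≤ ∑ a, p a * M :=
        sum_le_sum fun a _ => mul_le_mul_of_nonneg_left (hf a) (hp.1 a)
    _ = M := by rw [← sum_mul, hp.2, one_mul]

theorem IsDist.le_sum_mul {p f : A → ℝ} {M : ℝ} (hp : IsDist p) (hf : ∀ a, M ≤ f a) :
    M ≤ ∑ a, p a * f a := by
  calc M = ∑ a, p a * M := by rw [← sum_mul, hp.2, one_mul]
    _ ≤ ∑ a, p a * f a := sum_le_sum fun a _ => mul_le_mul_of_nonneg_left (hf a) (hp.1 a)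

theorem IsDist.le_one {p : A → ℝ} (hp : IsDist p) (a : A) : p a ≤ 1 :=
  hp.2 ▸ single_le_sum (fun b _ => hp.1 b) (mem_univ a)

theorem KL_eq_sum_klFun {p q : A → ℝ} (hp : IsDist p) (hq : IsDist q) (hpos : ∀ a, 0 < q a) :
    KL p q = ∑ a, q a * InformationTheory.klFun (p a / q a) := by
  have h : ∀ a, q a * InformationTheory.klFun (p a / q a)
      = p a * Real.log (p a / q a) + (q a - p a) := fun a => by
    have := (hpos a).ne'
    rw [InformationTheory.klFun]
    field_simp
    ring
  simp only [h, sum_add_distrib, sum_sub_distrib, hp.2, hq.2, KL]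
  ring

theorem KL_nonneg {p q : A → ℝ} (hp : IsDist p) (hq : IsDist q) (hpos : ∀ a, 0 < q a) :
    0 ≤ KL p q := by
  rw [KL_eq_sum_klFun hp hq hpos]
  exact sum_nonneg fun a _ => mul_nonneg (hpos a).le
    (InformationTheory.klFun_nonneg (div_nonneg (hp.1 a) (hpos a).le))

theorem eq_of_KL_nonpos {p q : A → ℝ} (hp : IsDist p) (hq : IsDist q) (hpos : ∀ a, 0 < q a)
    (h : KL p q ≤ 0) : p = q := by
  rw [KL_eq_sum_klFun hp hq hpos] at h
  have hnn : ∀ a ∈ univ, 0 ≤ q a * InformationTheory.klFun (p a / q a) := fun a _ =>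
    mul_nonneg (hpos a).le
      (InformationTheory.klFun_nonneg (div_nonneg (hp.1 a) (hpos a).le))
  have hz := (sum_eq_zero_iff_of_nonneg hnn).1 (le_antisymm h (sum_nonneg hnn))
  funext a
  have ha := (mul_eq_zero.1 (hz a (mem_univ a))).resolve_left (hpos a).ne'
  rw [InformationTheory.klFun_eq_zero_iff (div_nonneg (hp.1 a) (hpos a).le)] at ha
  rwa [div_eq_one_iff_eq (hpos a).ne'] at ha

theorem KL_self {p : A → ℝ} : KL p p = 0 := by
  refine sum_eq_zero fun a _ => ?_
  by_cases h : p a = 0 <;> simp [h]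

theorem KL_eq_sum_sub {p q : A → ℝ} (hpos : ∀ a, 0 < q a) :
    KL p q = ∑ a, p a * (Real.log (p a) - Real.log (q a)) := by
  refine sum_congr rfl fun a _ => ?_
  by_cases h : p a = 0
  · simp [h]
  · rw [Real.log_div h (hpos a).ne']

theorem KL_uniform_le [Nonempty A] {p q : A → ℝ} (hp : IsDist p)
    (hq : ∀ a, q a = 1 / (Fintype.card A : ℝ)) :
    KL p q ≤ Real.log (Fintype.card A : ℝ) := by
  have hcard : (0 : ℝ) < Fintype.card A := by exact_mod_cast Fintype.card_pos
  rw [KL_eq_sum_sub (fun a => by rw [hq]; positivity)]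
  refine hp.sum_mul_le fun a => ?_
  rw [hq, one_div, Real.log_inv]
  linarith [Real.log_nonpos (hp.1 a) (hp.le_one a)]

/-- The minimizer of an entropy-regularized linear objective is positive, is given by the
exponential-weights formula, and the objective exceeds its minimum by a multiple of the divergence
to the minimizer. -/
theorem mirror_step [Nonempty A] {Q p₀ pk p₁ : A → ℝ} {η τ : ℝ} (hη : 0 < 1 + η * τ)
    (h₀ : ∀ a, 0 < p₀ a) (hk : ∀ a, 0 < pk a) (h₁ : IsDist p₁)
    (hmin : ∀ p, IsDist p →
      η * ((∑ a, Q a * p₁ a) + τ * KL p₁ p₀) + KL p₁ pk ≤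
        η * ((∑ a, Q a * p a) + τ * KL p p₀) + KL p pk) :
    (∀ a, 0 < p₁ a) ∧ ∃ z : ℝ,
      (∀ a, (1 + η * τ) * Real.log (p₁ a)
        = -(η * Q a) + η * τ * Real.log (p₀ a) + Real.log (pk a) + z) ∧
      ∀ p, IsDist p → η * ((∑ a, Q a * p a) + τ * KL p p₀) + KL p pk
        = (1 + η * τ) * KL p p₁ + z := by
  set W : A → ℝ := fun a =>
    (-(η * Q a) + η * τ * Real.log (p₀ a) + Real.log (pk a)) / (1 + η * τ) with hW
  set Z : ℝ := ∑ a, Real.exp (W a) with hZ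
  have hZpos : 0 < Z := sum_pos (fun a _ => Real.exp_pos _) univ_nonempty
  set q : A → ℝ := fun a => Real.exp (W a) / Z with hq
  have hqpos : ∀ a, 0 < q a := fun a => div_pos (Real.exp_pos _) hZpos
  have hqd : IsDist q := ⟨fun a => (hqpos a).le, by
    simp only [hq, ← sum_div]; exact div_self hZpos.ne'⟩
  have hlog : ∀ a, (1 + η * τ) * Real.log (q a)
      = -(η * Q a) + η * τ * Real.log (p₀ a) + Real.log (pk a)
        + -((1 + η * τ) * Real.log Z) := fun a => by
    simp only [hq]
    rw [Real.log_div (Real.exp_pos _).ne' hZpos.ne', Real.log_exp, mul_sub, hW,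
      mul_div_cancel₀ _ hη.ne']
    ring
  have hobj : ∀ p, IsDist p → η * ((∑ a, Q a * p a) + τ * KL p p₀) + KL p pk
        = (1 + η * τ) * KL p q + -((1 + η * τ) * Real.log Z) := fun p hp => by
    rw [KL_eq_sum_sub h₀, KL_eq_sum_sub hk, KL_eq_sum_sub hqpos]
    have hz : -((1 + η * τ) * Real.log Z) = ∑ a, p a * -((1 + η * τ) * Real.log Z) := by
      rw [← sum_mul, hp.2, one_mul]
    rw [hz]
    simp only [mul_add, mul_sum, ← sum_add_distrib]
    refine sum_congr rfl fun a _ => ?_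
    linear_combination p a * hlog a
  have heq : p₁ = q := by
    refine eq_of_KL_nonpos h₁ hqd hqpos ?_
    have := hmin q hqd
    rw [hobj _ h₁, hobj _ hqd, KL_self] at this
    nlinarith
  subst heq
  exact ⟨hqpos, _, hlog, hobj⟩

end Divergence

section Evaluation

open Finset

variable {S A : Type*} [Fintype S] [Fintype A]

/-- One-step expectation of `x` from `s` under the policy `p`. -/
noncomputable def policyAvg (P : S → A → S → ℝ) (p : S → A → ℝ) (x : S → ℝ) (s : S) : ℝ :=
  ∑ a, p s a * ∑ s', P s a s' * x s'

variable {P : S → A → S → ℝ} {p : S → A → ℝ} {γ : ℝ} {c : S → A → ℝ}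

theorem policyAvg_le (hP : ∀ s a, IsDist (P s a)) (hp : IsPolicy p) {x : S → ℝ} {M : ℝ}
    (hx : ∀ s, x s ≤ M) (s : S) : policyAvg P p x s ≤ M :=
  (hp s).sum_mul_le fun a => (hP s a).sum_mul_le hx

theorem policyAvg_add (x y : S → ℝ) (s : S) :
    policyAvg P p (fun t => x t + y t) s = policyAvg P p x s + policyAvg P p y s := by
  simp only [policyAvg, mul_add, sum_add_distrib]

theorem policyAvg_sum {ι : Type*} (I : Finset ι) (w : ι → ℝ) (x : ι → S → ℝ) (s : S) :
    policyAvg P p (fun t => ∑ i ∈ I, w i * x i t) s = ∑ i ∈ I, w i * policyAvg P p (x i) s := by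
  simp only [policyAvg, mul_sum]
  rw [sum_comm (s := I)]
  refine sum_congr rfl fun a _ => ?_
  rw [sum_comm]
  exact sum_congr rfl fun i _ => sum_congr rfl fun t _ => by ring

theorem sum_mul_Qf_sub (x y : S → ℝ) (s : S) :
    ∑ a, p s a * Qf γ c P x s a - ∑ a, p s a * Qf γ c P y s a
      = γ * policyAvg P p (fun t => x t - y t) s := by
  rw [← sum_sub_distrib, policyAvg, mul_sum]
  refine sum_congr rfl fun a _ => ?_
  simp only [Qf, mul_sub, sum_sub_distrib]
  ring

theorem le_div_of_le_add_policyAvg [Nonempty S] (hγ : 0 < γ ∧ γ < 1)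
    (hP : ∀ s a, IsDist (P s a)) (hp : IsPolicy p) {x : S → ℝ} {r : ℝ}
    (hx : ∀ s, x s ≤ r + γ * policyAvg P p x s) (s : S) : x s ≤ r / (1 - γ) := by
  obtain ⟨t, ht⟩ := Finite.exists_max x
  refine (ht s).trans ?_
  rw [le_div_iff₀ (by linarith)]
  have h1 := policyAvg_le hP hp ht t
  nlinarith [hx t, mul_le_mul_of_nonneg_left h1 hγ.1.le]

theorem abs_value_le [Nonempty S] (hγ : 0 < γ ∧ γ < 1) (hP : ∀ s a, IsDist (P s a))
    (hp : IsPolicy p) {C : ℝ} (hC : ∀ s a, |c s a| ≤ C) {v : S → ℝ}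
    (hv : ∀ s, v s = ∑ a, p s a * Qf γ c P v s a) (s : S) : |v s| ≤ C / (1 - γ) := by
  have key : ∀ s, v s = ∑ a, p s a * c s a + γ * policyAvg P p v s := fun s => by
    conv_lhs => rw [hv s]
    rw [policyAvg, mul_sum, ← sum_add_distrib]
    refine sum_congr rfl fun a _ => ?_
    rw [Qf]; ring
  refine abs_le'.2 ⟨?_, ?_⟩
  · refine le_div_of_le_add_policyAvg hγ hP hp (fun s => ?_) s
    conv_lhs => rw [key s]
    linarith [(hp s).sum_mul_le fun a => (abs_le.1 (hC s a)).2]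
  · refine le_div_of_le_add_policyAvg (x := fun s => -v s) hγ hP hp (fun s => ?_) s
    have : policyAvg P p (fun s => -v s) s = -policyAvg P p v s := by simp [policyAvg]
    rw [this]
    have h2 := (hp s).le_sum_mul fun a => (abs_le.1 (hC s a)).1
    linarith [key s]

theorem value_le_of_sum_mul_Qf_le [Nonempty S] (hγ : 0 < γ ∧ γ < 1) (hP : ∀ s a, IsDist (P s a))
    (hp : IsPolicy p) {v x : S → ℝ}
    (hv : ∀ s, v s = ∑ a, p s a * Qf γ c P v s a)
    (hx : ∀ s, ∑ a, p s a * Qf γ c P x s a ≤ x s) (s : S) : v s ≤ x s := by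
  have h := le_div_of_le_add_policyAvg (x := fun s => v s - x s) (r := 0) hγ hP hp (fun s => by
    have := sum_mul_Qf_sub (γ := γ) (c := c) (P := P) (p := p) v x s
    linarith [hx s, hv s]) s
  rw [zero_div] at h
  linarith

theorem abs_Qf_le {S A : Type*} [Fintype S] {P : S → A → S → ℝ} {c : S → A → ℝ} {γ C : ℝ}
    (hγ : 0 < γ ∧ γ < 1) (hP : ∀ s a, IsDist (P s a))
    (hC : ∀ s a, |c s a| ≤ C) {v : S → ℝ} (hv : ∀ s, |v s| ≤ C / (1 - γ)) (s : S) (a : A) :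
    |Qf γ c P v s a| ≤ C / (1 - γ) := by
  have h1 := (hP s a).sum_mul_le fun t => (abs_le.1 (hv t)).2
  have h2 := (hP s a).le_sum_mul fun t => (abs_le.1 (hv t)).1
  have h3 := abs_le.1 (hC s a)
  have h4 : C + γ * (C / (1 - γ)) = C / (1 - γ) := by
    have : 1 - γ ≠ 0 := by linarith
    field_simp
    ring
  rw [Qf, abs_le]
  constructor <;> nlinarith [hγ.1]

end Evaluation

section Optimality

open Finset

variable {S A : Type*} [Fintype S] [Nonempty S] [Fintype A] [Nonempty A]
  {P : S → A → S → ℝ} {γ C : ℝ} {c : S → A → ℝ}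

theorem Qmin_le {S A : Type*} [Fintype A] [Nonempty A] (Q : S → A → ℝ) (s : S) (a : A) :
    Qmin Q s ≤ Q s a :=
  inf'_le _ (mem_univ a)

theorem exists_eq_Qmin {S A : Type*} [Fintype A] [Nonempty A] (Q : S → A → ℝ) (s : S) :
    ∃ a, Q s a = Qmin Q s := by
  obtain ⟨a, -, ha⟩ := exists_mem_eq_inf' (univ_nonempty (α := A)) (Q s)
  exact ⟨a, ha.symm⟩

/-- The probability that `p s` assigns to actions that do not minimize `Q s`. -/
noncomputable def suboptMass (Q : S → A → ℝ) (p : S → A → ℝ) (s : S) : ℝ :=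
  ∑ a, if Q s a = Qmin Q s then 0 else p s a

variable {V : (S → A → ℝ) → S → ℝ} {πstar : S → A → ℝ}

theorem Qmin_eq_value (hγ : 0 < γ ∧ γ < 1) (hP : ∀ s a, IsDist (P s a))
    (hV : ∀ π, IsPolicy π → ∀ s, V π s = ∑ a, π s a * Qf γ c P (V π) s a)
    (hopt : IsOptPolicy V πstar) (s : S) : Qmin (Qf γ c P (V πstar)) s = V πstar s := by
  classical
  have hle : ∀ s, Qmin (Qf γ c P (V πstar)) s ≤ V πstar s := fun s => by
    rw [hV πstar hopt.1 s]
    exact (hopt.1 s).le_sum_mul fun a => Qmin_le _ s a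
  choose g hg using exists_eq_Qmin (Qf γ c P (V πstar))
  set p : S → A → ℝ := fun s a => if a = g s then 1 else 0 with hpdef
  have hp : IsPolicy p := fun s => ⟨fun a => by simp only [hpdef]; split_ifs <;> norm_num,
    by simp [hpdef]⟩
  have hsum : ∀ s, ∑ a, p s a * Qf γ c P (V πstar) s a = Qmin (Qf γ c P (V πstar)) s :=
    fun s => by simp [hpdef, hg]
  have h1 := value_le_of_sum_mul_Qf_le hγ hP hp (hV p hp) (fun s => (hsum s).trans_le (hle s))
  have h2 : V p = V πstar := funext fun s => le_antisymm (h1 s) (hopt.2 p hp s)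
  have h3 := hV p hp s
  rw [h2, hsum] at h3
  exact h3.symm

theorem isOptPolicy_of_support (hγ : 0 < γ ∧ γ < 1) (hP : ∀ s a, IsDist (P s a))
    (hV : ∀ π, IsPolicy π → ∀ s, V π s = ∑ a, π s a * Qf γ c P (V π) s a)
    (hopt : IsOptPolicy V πstar) {p : S → A → ℝ} (hp : IsPolicy p)
    (hsupp : ∀ s a, Qf γ c P (V πstar) s a ≠ Qmin (Qf γ c P (V πstar)) s → p s a = 0) :
    IsOptPolicy V p := by
  refine ⟨hp, fun π' hπ' s => le_trans ?_ (hopt.2 π' hπ' s)⟩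
  refine value_le_of_sum_mul_Qf_le hγ hP hp (hV p hp) (fun s => le_of_eq ?_) s
  calc ∑ a, p s a * Qf γ c P (V πstar) s a = ∑ a, p s a * V πstar s :=
        sum_congr rfl fun a _ => by
          by_cases h : Qf γ c P (V πstar) s a = Qmin (Qf γ c P (V πstar)) s
          · rw [h, Qmin_eq_value hγ hP hV hopt]
          · rw [hsupp s a h, zero_mul, zero_mul]
    _ = V πstar s := by rw [← sum_mul, (hp s).2, one_mul]

theorem suboptMass_nonneg {S A : Type*} [Fintype A] [Nonempty A] {Q p : S → A → ℝ}
    (hp : IsPolicy p) (s : S) :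
    0 ≤ suboptMass Q p s :=
  sum_nonneg fun a _ => by split_ifs; exacts [le_rfl, (hp s).1 a]

theorem distL1_le (hγ : 0 < γ ∧ γ < 1) (hP : ∀ s a, IsDist (P s a))
    (hV : ∀ π, IsPolicy π → ∀ s, V π s = ∑ a, π s a * Qf γ c P (V π) s a)
    (hopt : IsOptPolicy V πstar) {p : S → A → ℝ} (hp : IsPolicy p) {m : ℝ}
    (hm : ∀ s, suboptMass (Qf γ c P (V πstar)) p s ≤ m) : distL1 V p ≤ 2 * m := by
  classical
  set Q := Qf γ c P (V πstar) with hQ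
  choose g hg using exists_eq_Qmin Q
  set q : S → A → ℝ := fun s a => (if Q s a = Qmin Q s then p s a else 0)
    + if a = g s then suboptMass Q p s else 0 with hq
  have hsplit : ∀ s, ∑ a, (if Q s a = Qmin Q s then p s a else 0) + suboptMass Q p s = 1 :=
    fun s => by
      rw [suboptMass, ← sum_add_distrib, ← (hp s).2]
      exact sum_congr rfl fun a _ => by split_ifs <;> simp
  have hqp : IsPolicy q := fun s => ⟨fun a => add_nonneg
      (by split_ifs; exacts [(hp s).1 a, le_rfl])
      (by split_ifs; exacts [suboptMass_nonneg hp s, le_rfl]), by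
    simp only [hq, sum_add_distrib, sum_ite_eq', mem_univ, if_true]
    simpa using hsplit s⟩
  have hqo : IsOptPolicy V q := isOptPolicy_of_support hγ hP hV hopt hqp fun s a ha => by
    have : a ≠ g s := fun h => ha (h ▸ hg s)
    simp only [hq]
    rw [if_neg ha, if_neg this, add_zero]
  refine sup'_le _ _ fun s _ => ?_
  have hbdd : BddBelow {x : ℝ | ∃ π', IsOptPolicy V π' ∧ x = ∑ a, |p s a - π' s a|} := by
    refine ⟨0, ?_⟩
    rintro x ⟨π', -, rfl⟩
    exact sum_nonneg fun a _ => abs_nonneg _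
  refine (csInf_le hbdd ⟨q, hqo, rfl⟩).trans ?_
  calc ∑ a, |p s a - q s a|
        ≤ ∑ a, ((if Q s a = Qmin Q s then 0 else p s a)
            + if a = g s then suboptMass Q p s else 0) := by
          refine sum_le_sum fun a _ => ?_
          have h1 := (hp s).1 a
          have h2 := suboptMass_nonneg (Q := Q) hp s
          simp only [hq]
          rw [abs_le]
          split_ifs <;> constructor <;> linarith
      _ = 2 * suboptMass Q p s := by
          rw [sum_add_distrib, sum_ite_eq', if_pos (mem_univ _), two_mul, suboptMass]
      _ ≤ 2 * m := by linarith [hm s]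

theorem value_sub_le (hγ : 0 < γ ∧ γ < 1) (hP : ∀ s a, IsDist (P s a))
    (hC : ∀ s a, |c s a| ≤ C)
    (hV : ∀ π, IsPolicy π → ∀ s, V π s = ∑ a, π s a * Qf γ c P (V π) s a)
    (hopt : IsOptPolicy V πstar) {p : S → A → ℝ} (hp : IsPolicy p) {m : ℝ}
    (hm : ∀ s, suboptMass (Qf γ c P (V πstar)) p s ≤ m) (s : S) :
    V p s - V πstar s ≤ 2 * C / (1 - γ) ^ 2 * m := by
  have hδ : 0 < 1 - γ := by linarith [hγ.2]
  have hC0 : 0 ≤ C := (abs_nonneg _).trans (hC s (Classical.arbitrary A))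
  have hVs := abs_value_le hγ hP hopt.1 hC (hV πstar hopt.1)
  have h := le_div_of_le_add_policyAvg (x := fun s => V p s - V πstar s)
    (r := 2 * (C / (1 - γ)) * m) hγ hP hp (fun s => ?_) s
  · convert h using 1
    field_simp
  · have h1 := sum_mul_Qf_sub (γ := γ) (c := c) (P := P) (p := p) (V p) (V πstar) s
    have h2 : ∑ a, p s a * Qf γ c P (V πstar) s a - V πstar s
        ≤ 2 * (C / (1 - γ)) * suboptMass (Qf γ c P (V πstar)) p s := by
      have h3 : V πstar s = ∑ a, p s a * V πstar s := by rw [← sum_mul, (hp s).2, one_mul]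
      rw [suboptMass, mul_sum]
      conv_lhs => rw [h3]
      rw [← sum_sub_distrib]
      refine sum_le_sum fun a _ => ?_
      split_ifs with ha
      · rw [ha, Qmin_eq_value hγ hP hV hopt]; simp
      · rw [← mul_sub, mul_comm]
        refine mul_le_mul_of_nonneg_right ?_ ((hp s).1 a)
        linarith [(abs_le.1 (abs_Qf_le hγ hP hC hVs s a)).2, (abs_le.1 (hVs s)).1]
    have h4 := mul_le_mul_of_nonneg_left (hm s)
      (mul_nonneg zero_le_two (div_nonneg hC0 hδ.le))
    linarith [hV p hp s]

end Optimality

section Iteration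

open Finset

theorem mirror_step_recursion {A : Type*} [Fintype A] [Nonempty A] {Q p₀ pk p₁ : A → ℝ} {n : ℝ}
    (hn : 0 < n) (h₀ : ∀ a, p₀ a = 1 / (Fintype.card A : ℝ)) (hkd : IsDist pk)
    (hk : ∀ a, 0 < pk a) (h₁ : IsDist p₁)
    (hmin : ∀ p, IsDist p →
      n * ((∑ a, Q a * p₁ a) + 1 / n ^ 2 * KL p₁ p₀) + KL p₁ pk ≤
        n * ((∑ a, Q a * p a) + 1 / n ^ 2 * KL p p₀) + KL p pk) :
    (∀ a, 0 < p₁ a) ∧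
    (∀ a b, (n + 1) * (Real.log (p₁ a) - Real.log (p₁ b))
      = n * (Real.log (pk a) - Real.log (pk b)) - n ^ 2 * (Q a - Q b)) ∧
    (∀ p, IsDist p → n ^ 2 * (∑ a, Q a * p₁ a - ∑ a, Q a * p a) + (n + 1) * KL p p₁
      ≤ n * KL p pk + Real.log (Fintype.card A : ℝ)) := by
  have hcard : (0 : ℝ) < Fintype.card A := by exact_mod_cast Fintype.card_pos
  have h₀pos : ∀ a, 0 < p₀ a := fun a => by rw [h₀]; positivity
  have h₀d : IsDist p₀ := ⟨fun a => (h₀pos a).le, by simp [h₀]⟩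
  obtain ⟨hpos, z, hlog, hobj⟩ := mirror_step (by positivity) h₀pos hk h₁ hmin
  have hfac : n * (1 + n * (1 / n ^ 2)) = n + 1 := by field_simp
  refine ⟨hpos, fun a b => ?_, fun p hp => ?_⟩
  · have ha := hlog a
    have hb := hlog b
    rw [h₀] at ha hb
    rw [← hfac]
    linear_combination n * ha - n * hb
  · have e1 := hobj p hp
    have e2 := hobj p₁ h₁
    rw [KL_self] at e2
    have hsq : n * n * (1 / n ^ 2) = 1 := by field_simp
    have e3 : n ^ 2 * (∑ a, Q a * p₁ a - ∑ a, Q a * p a) + (n + 1) * KL p p₁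
        = n * KL p pk + KL p p₀ - KL p₁ p₀ - n * KL p₁ pk := by
      rw [← hfac]
      linear_combination n * e2 - n * e1 + (KL p p₀ - KL p₁ p₀) * hsq
    have := KL_uniform_le hp h₀
    have := KL_nonneg h₁ h₀d h₀pos
    have := mul_nonneg hn.le (KL_nonneg h₁ hkd hk)
    linarith

theorem sub_le_sum_mul_sub_of_antitone {θ M : ℕ → ℝ} (hθ : Antitone θ) (hM : ∀ i, 0 ≤ M i)
    (k : ℕ) : θ k * M k - θ 0 * M 0 ≤ ∑ i ∈ range k, θ i * (M (i + 1) - M i) := by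
  induction k with
  | zero => simp
  | succ k ih =>
    rw [sum_range_succ]
    have := mul_le_mul_of_nonneg_right (hθ k.le_succ) (hM (k + 1))
    linarith

variable {S A : Type*} [Fintype S] [Nonempty S] [Fintype A]
  {P : S → A → S → ℝ} {p : S → A → ℝ} {γ : ℝ}

/-- Weighted sums of a sequence that contracts up to a telescoping divergence term. -/
theorem weighted_sum_le (hγ : 0 < γ ∧ γ < 1) (hP : ∀ s a, IsDist (P s a)) (hp : IsPolicy p)
    {e D : ℕ → S → ℝ} {n v θ : ℕ → ℝ} {B L ρ G : ℝ} (he : ∀ i s, 0 ≤ e i s)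
    (hD : ∀ i s, 0 ≤ D i s) (hn : ∀ i, 0 ≤ n i) (hρ : 0 ≤ ρ)
    (hrec : ∀ i s, n i ^ 2 * e (i + 1) s + n (i + 1) * D (i + 1) s
      ≤ γ * (n i ^ 2 * policyAvg P p (e i) s) + n i * D i s + ρ)
    (hB : ∀ s, e 0 s ≤ B) (hL : ∀ s, D 0 s ≤ L)
    (hθ : Antitone θ) (hθ0 : ∀ i, 0 ≤ θ i) (hθ1 : ∀ i, θ i ≤ 1)
    (hv : ∀ i, v i = θ i * n i ^ 2) (k : ℕ)
    (hG : ∀ s, ∑ i ∈ range k, (v (i + 1) - v i) * e (i + 1) s ≤ G) (s : S) :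
    ∑ i ∈ range k, v (i + 1) * e (i + 1) s
      ≤ (γ * (v 0 * B) + (n 0 * L + k * ρ) + G) / (1 - γ) := by
  have hv0 : ∀ i, 0 ≤ v i := fun i => by rw [hv]; exact mul_nonneg (hθ0 i) (sq_nonneg _)
  refine le_div_of_le_add_policyAvg
    (x := fun s => ∑ i ∈ range k, v (i + 1) * e (i + 1) s) hγ hP hp (fun s => ?_) s
  have hsum : ∑ i ∈ range k, v i * e (i + 1) s
      ≤ γ * policyAvg P p (fun t => ∑ i ∈ range k, v i * e i t) s + (n 0 * L + k * ρ) := by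
    have h1 : ∑ i ∈ range k, (v i * e (i + 1) s + θ i * (n (i + 1) * D (i + 1) s - n i * D i s))
        ≤ ∑ i ∈ range k, (γ * (v i * policyAvg P p (e i) s) + ρ) := by
      refine sum_le_sum fun i _ => ?_
      have h2 := mul_le_mul_of_nonneg_left (hrec i s) (hθ0 i)
      have h3 := mul_le_mul_of_nonneg_right (hθ1 i) hρ
      rw [hv]
      linarith
    rw [sum_add_distrib, sum_add_distrib, ← mul_sum, sum_const, card_range, nsmul_eq_mul] at h1
    have h4 := sub_le_sum_mul_sub_of_antitone (M := fun i => n i * D i s) hθ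
      (fun i => mul_nonneg (hn i) (hD i s)) k
    have h5 : 0 ≤ θ k * (n k * D k s) := mul_nonneg (hθ0 k) (mul_nonneg (hn k) (hD k s))
    have h6 : θ 0 * (n 0 * D 0 s) ≤ n 0 * L :=
      (mul_le_of_le_one_left (mul_nonneg (hn 0) (hD 0 s)) (hθ1 0)).trans
        (mul_le_mul_of_nonneg_left (hL s) (hn 0))
    rw [policyAvg_sum]
    linarith
  have hmono : policyAvg P p (fun t => ∑ i ∈ range k, v i * e i t) s
      ≤ v 0 * B + policyAvg P p (fun t => ∑ i ∈ range k, v (i + 1) * e (i + 1) t) s := by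
    have h1 : policyAvg P p (fun t => ∑ i ∈ range k, v i * e i t
        - ∑ i ∈ range k, v (i + 1) * e (i + 1) t) s ≤ v 0 * B := by
      refine policyAvg_le hP hp (fun t => ?_) s
      rw [← sum_sub_distrib, sum_range_sub' (fun i => v i * e i t)]
      linarith [mul_nonneg (hv0 k) (he k t), mul_le_mul_of_nonneg_left (hB t) (hv0 0)]
    have h2 := policyAvg_add (P := P) (p := p) (fun t => ∑ i ∈ range k, v i * e i t
        - ∑ i ∈ range k, v (i + 1) * e (i + 1) t)
        (fun t => ∑ i ∈ range k, v (i + 1) * e (i + 1) t) s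
    simp only [sub_add_cancel] at h2
    linarith
  have hG' := hG s
  simp only [sub_mul, sum_sub_distrib] at hG'
  have := mul_le_mul_of_nonneg_left hmono hγ.1.le
  linarith

theorem sum_sq_mul_le (hγ : 0 < γ ∧ γ < 1) (hP : ∀ s a, IsDist (P s a)) (hp : IsPolicy p)
    {e D : ℕ → S → ℝ} {n : ℕ → ℝ} {B L ρ : ℝ} (he : ∀ i s, 0 ≤ e i s)
    (hD : ∀ i s, 0 ≤ D i s) (hn0 : 1 ≤ n 0) (hn : ∀ i, n (i + 1) = n i + 1) (hρ : 0 ≤ ρ)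
    (hrec : ∀ i s, n i ^ 2 * e (i + 1) s + n (i + 1) * D (i + 1) s
      ≤ γ * (n i ^ 2 * policyAvg P p (e i) s) + n i * D i s + ρ)
    (hB : ∀ s, e 0 s ≤ B) (hL : ∀ s, D 0 s ≤ L) (k : ℕ) (s : S) :
    ∑ i ∈ range (k + 1), n i ^ 2 * e i s
      ≤ n 0 ^ 2 * B + (γ * (n 0 ^ 2 * B) + (n 0 * L + k * ρ)
        + (γ * ((2 * n 0 - 1) * B) + (n 0 * L + k * ρ)
          + 2 * ((γ * B + (n 0 * L + k * ρ)) / (1 - γ))) / (1 - γ)) / (1 - γ) := by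
  have hn1 : ∀ i, 1 ≤ n i := fun i => by
    induction i with
    | zero => exact hn0
    | succ i ih => rw [hn]; linarith
  have hnn : ∀ i, 0 ≤ n i := fun i => by linarith [hn1 i]
  have hsq : ∀ i, 0 < n i ^ 2 := fun i => by have := hn1 i; positivity
  have b0 := weighted_sum_le (v := fun _ => 1) (θ := fun i => 1 / n i ^ 2) (G := 0)
    hγ hP hp he hD hnn hρ hrec hB hL
    (antitone_nat_of_succ_le fun i => one_div_le_one_div_of_le (hsq i)
      (pow_le_pow_left₀ (hnn i) (by rw [hn]; linarith) 2))
    (fun i => (one_div_pos.2 (hsq i)).le)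
    (fun i => (div_le_one (hsq i)).2 (by nlinarith [hn1 i]))
    (fun i => (one_div_mul_cancel (hsq i).ne').symm) k (fun s => by simp)
  simp only [one_mul, add_zero] at b0
  have b1 := weighted_sum_le (v := fun i => 2 * n i - 1) (θ := fun i => (2 * n i - 1) / n i ^ 2)
    (G := 2 * ((γ * B + (n 0 * L + k * ρ)) / (1 - γ)))
    hγ hP hp he hD hnn hρ hrec hB hL
    (antitone_nat_of_succ_le fun i => by
      rw [div_le_div_iff₀ (hsq _) (hsq _), hn]
      nlinarith [hn1 i, mul_nonneg (hnn i) (hnn i)])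
    (fun i => div_nonneg (by linarith [hn1 i]) (hsq i).le)
    (fun i => (div_le_one (hsq i)).2 (by nlinarith [sq_nonneg (n i - 1)]))
    (fun i => (div_mul_cancel₀ _ (hsq i).ne').symm) k (fun s => by
      refine le_trans (le_of_eq ?_) (mul_le_mul_of_nonneg_left (b0 s) zero_le_two)
      rw [mul_sum]
      exact sum_congr rfl fun i _ => by rw [hn]; ring)
  have b2 := weighted_sum_le (v := fun i => n i ^ 2) (θ := fun _ => 1)
    (G := (γ * ((2 * n 0 - 1) * B) + (n 0 * L + k * ρ)
          + 2 * ((γ * B + (n 0 * L + k * ρ)) / (1 - γ))) / (1 - γ))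
    hγ hP hp he hD hnn hρ hrec hB hL antitone_const (fun _ => zero_le_one) (fun _ => le_rfl)
    (fun i => (one_mul _).symm) k (fun s => by
      refine le_trans (le_of_eq ?_) (b1 s)
      exact sum_congr rfl fun i _ => by rw [hn]; ring) s
  rw [sum_range_succ']
  have := mul_le_mul_of_nonneg_left (hB s) (hsq 0).le
  linarith

end Iteration

section Arithmetic

theorem neg_le_mul_log {x : ℝ} (hx : 0 < x) : -0.37 ≤ x * Real.log x := by
  have h1 := Real.one_sub_inv_le_log_of_pos (mul_pos hx (Real.exp_pos 1))
  rw [Real.log_mul hx.ne' (Real.exp_pos 1).ne', Real.log_exp] at h1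
  have h2 : x * (x * Real.exp 1)⁻¹ ≤ 0.37 := by
    rw [mul_inv, ← mul_assoc, mul_inv_cancel₀ hx.ne', one_mul]
    have := Real.exp_one_gt_d9
    rw [inv_le_comm₀ (Real.exp_pos 1) (by norm_num)]
    norm_num
    linarith
  nlinarith [mul_le_mul_of_nonneg_left h1 hx.le]

theorem sub_one_le_mul_log {x : ℝ} (hx : 0 < x) : x - 1 ≤ x * Real.log x := by
  have h := mul_le_mul_of_nonneg_left (Real.one_sub_inv_le_log_of_pos hx) hx.le
  rwa [mul_sub, mul_one, mul_inv_cancel₀ hx.ne'] at h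

theorem threshold_arith {x y d k : ℝ} {m : ℕ} (hm : 1 ≤ m) (hx : 0 < x) (hd0 : 0 < d)
    (hd : d ≤ m + 1) (hy : y = x * Real.log x + 2 * m) (hk : y ^ 3 ≤ k) :
    ∃ ε : ℝ, 0 ≤ ε ∧ ε ≤ 1 / 12 ∧ x * d ^ 3 / 8 ≤ ε * k ^ 2 ∧
      3 / 8 * (5 * (m : ℝ) ^ 3 + m ^ 2) + ε * (k + 1 + m)
        ≤ (k + 1 + m) / 3 + (4 * m + 1) / 6 := by
  have h1 : 2 * (m : ℝ) - 0.37 ≤ y := by linarith [neg_le_mul_log hx]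
  have h2 : x + (2 * m - 1) ≤ y := by linarith [sub_one_le_mul_log hx]
  have hm' : (1 : ℝ) ≤ m := by exact_mod_cast hm
  have hk1 : (2 * (m : ℝ) - 0.37) ^ 3 ≤ k := (pow_le_pow_left₀ (by linarith) h1 3).trans hk
  have hk2 : (x + (2 * m - 1)) ^ 6 ≤ k ^ 2 := by
    have := pow_le_pow_left₀ (pow_nonneg (by linarith) 3)
      ((pow_le_pow_left₀ (by linarith) h2 3).trans hk) 2
    calc _ = ((x + (2 * (m : ℝ) - 1)) ^ 3) ^ 2 := by ring
      _ ≤ _ := this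
  have hd3 : x * d ^ 3 ≤ x * (m + 1) ^ 3 := by gcongr
  rcases hm.eq_or_lt with rfl | hm2
  · refine ⟨1 / 12, by norm_num, le_rfl, ?_, ?_⟩
    · norm_num at hk2 hd3
      have : 12 * x ≤ (x + 1) ^ 6 := by
        have : 0 ≤ x ^ 3 * (20 + 15 * x + 6 * x ^ 2 + x ^ 3) := by positivity
        nlinarith [sq_nonneg (5 * x - 1)]
      linarith
    · norm_num at hk1 ⊢
      linarith
  · have hm2' : (2 : ℝ) ≤ m := by exact_mod_cast hm2
    refine ⟨1 / 30, by norm_num, by norm_num, ?_, ?_⟩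
    · have h3 : 6 * x * (m + 1) ^ 3 ≤ (x + (2 * m - 1)) ^ 6 := by
        calc 6 * x * ((m : ℝ) + 1) ^ 3 ≤ 6 * x * (2 * m - 1) ^ 3 := by gcongr; linarith
          _ ≤ 6 * x * (2 * m - 1) ^ 5 := by gcongr <;> linarith
          _ ≤ (x + (2 * m - 1)) ^ 6 := by
              set t : ℝ := 2 * m - 1 with ht
              have ht0 : 0 ≤ t := by linarith
              have : 0 ≤ x ^ 6 + 6 * x ^ 5 * t + 15 * x ^ 4 * t ^ 2 + 20 * x ^ 3 * t ^ 3
                + 15 * x ^ 2 * t ^ 4 + t ^ 6 := by positivity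
              nlinarith
      have : 0 < x * ((m : ℝ) + 1) ^ 3 := by positivity
      linarith
    · nlinarith [mul_nonneg (by linarith : (0 : ℝ) ≤ m) (sq_nonneg ((m : ℝ) - 1.7)),
        sq_nonneg ((m : ℝ) - 1.7)]

theorem sum_sq_range_add (m k : ℕ) :
    ∑ i ∈ Finset.range (k + 1), ((i : ℝ) + m) ^ 2
      = ((k : ℝ) + 1) * (6 * m ^ 2 + 6 * m * k + k * (2 * k + 1)) / 6 := by
  induction k with
  | zero => simp
  | succ k ih => rw [Finset.sum_range_succ, ih]; push_cast; ring

/-- The accumulated value error is dominated by the accumulated gap. -/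
theorem exponent_arith {γ d C L ϱ Δ x y X W k : ℝ} {m : ℕ} (hm : 1 ≤ m) (hγ : 0 < γ)
    (hd1 : 1 ≤ d) (hγd : γ * d = d - 1) (hd : d ≤ m + 1) (hC : 0 ≤ C) (hL : 0 ≤ L)
    (hϱ : γ ≤ ϱ) (hΔ : 0 < Δ) (hx : 0 < x) (hxΔ : x * Δ = 32 * ϱ * L * d)
    (hy : y = x * Real.log x + 2 * m) (hk0 : 0 ≤ k) (hk : y ^ 3 ≤ k)
    (hCΔ : C * d / 3 ≤ Δ * k ^ 2 / 16)
    (hX : X ≤ m ^ 2 * (2 * C * d) + (γ * (m ^ 2 * (2 * C * d)) + (m * L + k * (L * d))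
        + (γ * ((2 * m - 1) * (2 * C * d)) + (m * L + k * (L * d))
          + 2 * ((γ * (2 * C * d) + (m * L + k * (L * d))) * d)) * d) * d)
    (hW : W = (k + 1) * (6 * m ^ 2 + 6 * m * k + k * (2 * k + 1)) / 6) :
    γ * X + Δ * k ^ 2 / 16 * (k + 1 + m) ≤ C * d / 3 * (k + 1 + m) + Δ * W := by
  obtain ⟨ε, hε0, hε1, hε2, hε3⟩ := threshold_arith hm hx (by linarith) hd hy hk
  have hm' : (1 : ℝ) ≤ m := by exact_mod_cast hm
  set R : ℝ := m * L + k * (L * d) with hR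
  set N : ℝ := k + 1 + m with hN
  set T : ℝ := 5 * (m : ℝ) ^ 3 + m ^ 2 with hT
  have hRN : R ≤ L * d * N := by
    have : 0 ≤ L * d := by positivity
    nlinarith [mul_nonneg (mul_nonneg hL (by linarith : (0 : ℝ) ≤ m)) (by linarith : 0 ≤ d - 1)]
  have hR0 : 0 ≤ R := by positivity
  have hg0 : 0 ≤ d - 1 := by linarith
  have hgm : d - 1 ≤ m := by linarith
  have hsplit : γ * X ≤ 2 * C * d * ((d - 1) * m ^ 2 + (d - 1) ^ 2 * (2 * m - 1)
      + 2 * d * (d - 1) ^ 2) + γ * R * (d + d ^ 2 + 2 * d ^ 3) := by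
    refine (mul_le_mul_of_nonneg_left hX hγ.le).trans (le_of_eq ?_)
    rw [← hγd]
    linear_combination (γ * m ^ 2 * (2 * C * d)) * hγd
  have hCpart : (d - 1) * (m : ℝ) ^ 2 + (d - 1) ^ 2 * (2 * m - 1) + 2 * d * (d - 1) ^ 2 ≤ T := by
    have hsq : (d - 1) ^ 2 ≤ (m : ℝ) ^ 2 := pow_le_pow_left₀ hg0 hgm 2
    have i1 : (d - 1) * (m : ℝ) ^ 2 ≤ m * m ^ 2 := by gcongr
    have i2 : (d - 1) ^ 2 * (2 * (m : ℝ) - 1) ≤ m ^ 2 * (2 * m - 1) := by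
      gcongr; linarith
    have i3 : d * (d - 1) ^ 2 ≤ (m + 1) * (m : ℝ) ^ 2 := by gcongr
    rw [hT]; nlinarith
  have hLpart : γ * R * (d + d ^ 2 + 2 * d ^ 3) ≤ Δ * (ε * k ^ 2) * N := by
    have hN0 : 0 ≤ N := by positivity
    have hd2 : d ^ 2 ≤ d ^ 3 := pow_le_pow_right₀ hd1 (by norm_num)
    have hd3 : d ≤ d ^ 3 := le_self_pow₀ hd1 (by norm_num)
    calc γ * R * (d + d ^ 2 + 2 * d ^ 3) ≤ γ * (L * d * N) * (4 * d ^ 3) := by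
          gcongr; linarith
      _ = (32 * γ * L * d) * (d ^ 3 / 8 * N) := by ring
      _ ≤ (32 * ϱ * L * d) * (d ^ 3 / 8 * N) := by gcongr
      _ = Δ * (x * d ^ 3 / 8) * N := by rw [← hxΔ]; ring
      _ ≤ Δ * (ε * k ^ 2) * N := by gcongr
  have hWlow : N * k ^ 2 / 3 + (4 * m + 1) / 6 * k ^ 2 ≤ W := by
    have : 0 ≤ 6 * (m : ℝ) ^ 2 * k + 6 * m ^ 2 + 6 * m * k + k := by positivity
    rw [hW, hN]
    linarith
  have hCT := mul_le_mul_of_nonneg_left hCpart (by positivity : 0 ≤ 2 * C * d)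
  have hWΔ := mul_le_mul_of_nonneg_left hWlow hΔ.le
  have hΔk : 0 ≤ Δ * k ^ 2 := by positivity
  have hε3' := mul_le_mul_of_nonneg_left hε3 hΔk
  rcases le_total (2 * T) (N / 3) with hcase | hcase
  · have j1 := mul_le_mul_of_nonneg_left hcase (by positivity : 0 ≤ C * d)
    have j2 : 0 ≤ (1 / 12 - ε) * (Δ * k ^ 2 * N) :=
      mul_nonneg (by linarith) (by positivity)
    have j3 : 0 ≤ Δ * k ^ 2 * N := by positivity
    have j4 : 0 ≤ Δ * k ^ 2 * m := by positivity
    linarith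
  · have j1 := mul_le_mul_of_nonneg_right hCΔ (by linarith : 0 ≤ 3 * (2 * T - N / 3))
    linarith

end Arithmetic

section Convergence

open Finset

variable {S A : Type*} [Fintype S] [Fintype A] {P : S → A → S → ℝ} {γ : ℝ}
  {c : S → A → ℝ}

/-- Approximate policy improvement bounds the value of the new policy by its one-step lookahead. -/
theorem value_le_lookahead_add [Nonempty S] (hγ : 0 < γ ∧ γ < 1) (hP : ∀ s a, IsDist (P s a))
    {q : S → A → ℝ} (hq : IsPolicy q) {v w : S → ℝ} (hw : ∀ s, w s = ∑ a, q s a * Qf γ c P w s a) {r : ℝ}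
    (hr : ∀ s, ∑ a, q s a * Qf γ c P v s a - v s ≤ r) (s : S) :
    w s ≤ ∑ a, q s a * Qf γ c P v s a + γ * (r / (1 - γ)) := by
  have key := fun s => sum_mul_Qf_sub (γ := γ) (c := c) (P := P) (p := q) w v s
  have h1 := le_div_of_le_add_policyAvg (x := fun s => w s - v s) (r := r) hγ hP hq fun s => by
    linarith [key s, hw s, hr s]
  have h2 := mul_le_mul_of_nonneg_left (policyAvg_le hP hq h1 s) hγ.1.le
  linarith [key s, hw s]

variable [Nonempty A] {V : (S → A → ℝ) → S → ℝ} {πstar : S → A → ℝ} {π : ℕ → S → A → ℝ}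
  {n : ℕ → ℝ}

theorem hpmd_pos (hn : ∀ i, 0 < n i) (hpol : ∀ k, IsPolicy (π k))
    (hinit : ∀ s a, π 0 s a = 1 / (Fintype.card A : ℝ))
    (hstep : ∀ k s, ∀ p : A → ℝ, IsDist p →
      n k * ((∑ a, Qf γ c P (V (π k)) s a * π (k + 1) s a)
          + 1 / n k ^ 2 * KL (π (k + 1) s) (π 0 s)) + KL (π (k + 1) s) (π k s) ≤
      n k * ((∑ a, Qf γ c P (V (π k)) s a * p a) + 1 / n k ^ 2 * KL p (π 0 s)) + KL p (π k s))
    (k : ℕ) (s : S) (a : A) : 0 < π k s a := by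
  induction k generalizing a with
  | zero =>
    have : (0 : ℝ) < Fintype.card A := by exact_mod_cast Fintype.card_pos
    rw [hinit]
    positivity
  | succ k ih =>
    exact (mirror_step_recursion (hn k) (hinit s) (hpol k s) ih (hpol (k + 1) s) (hstep k s)).1 a

theorem hpmd_log_ratio (hn : ∀ i, 0 < n i) (hn1 : ∀ i, n (i + 1) = n i + 1)
    (hpol : ∀ k, IsPolicy (π k))
    (hinit : ∀ s a, π 0 s a = 1 / (Fintype.card A : ℝ))
    (hstep : ∀ k s, ∀ p : A → ℝ, IsDist p →
      n k * ((∑ a, Qf γ c P (V (π k)) s a * π (k + 1) s a)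
          + 1 / n k ^ 2 * KL (π (k + 1) s) (π 0 s)) + KL (π (k + 1) s) (π k s) ≤
      n k * ((∑ a, Qf γ c P (V (π k)) s a * p a) + 1 / n k ^ 2 * KL p (π 0 s)) + KL p (π k s))
    (k : ℕ) (s : S) (a b : A) :
    n k * (Real.log (π k s a) - Real.log (π k s b))
      = -∑ i ∈ range k, n i ^ 2 * (Qf γ c P (V (π i)) s a - Qf γ c P (V (π i)) s b) := by
  induction k with
  | zero => simp [hinit]
  | succ k ih =>
    rw [sum_range_succ, hn1, (mirror_step_recursion (hn k) (hinit s) (hpol k s)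
      (hpmd_pos hn hpol hinit hstep k s) (hpol (k + 1) s) (hstep k s)).2.1 a b, ih]
    ring

theorem hpmd_value_recursion [Nonempty S] (hγ : 0 < γ ∧ γ < 1) (hP : ∀ s a, IsDist (P s a))
    (hV : ∀ π, IsPolicy π → ∀ s, V π s = ∑ a, π s a * Qf γ c P (V π) s a)
    (hπstar : IsPolicy πstar) (hn : ∀ i, 0 < n i) (hn1 : ∀ i, n (i + 1) = n i + 1)
    (hpol : ∀ k, IsPolicy (π k))
    (hinit : ∀ s a, π 0 s a = 1 / (Fintype.card A : ℝ))
    (hstep : ∀ k s, ∀ p : A → ℝ, IsDist p →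
      n k * ((∑ a, Qf γ c P (V (π k)) s a * π (k + 1) s a)
          + 1 / n k ^ 2 * KL (π (k + 1) s) (π 0 s)) + KL (π (k + 1) s) (π k s) ≤
      n k * ((∑ a, Qf γ c P (V (π k)) s a * p a) + 1 / n k ^ 2 * KL p (π 0 s)) + KL p (π k s))
    (i : ℕ) (s : S) :
    n i ^ 2 * (V (π (i + 1)) s - V πstar s) + n (i + 1) * KL (πstar s) (π (i + 1) s)
      ≤ γ * (n i ^ 2 * policyAvg P πstar (fun t => V (π i) t - V πstar t) s)
        + n i * KL (πstar s) (π i s) + Real.log (Fintype.card A : ℝ) / (1 - γ) := by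
  set L := Real.log (Fintype.card A : ℝ) with hL
  have hδ : 0 < 1 - γ := by linarith [hγ.2]
  have hpos := hpmd_pos hn hpol hinit hstep
  have hni := hn i
  have hni1 := hn (i + 1)
  have three : ∀ s p, IsDist p → n i ^ 2 * (∑ a, π (i + 1) s a * Qf γ c P (V (π i)) s a
      - ∑ a, p a * Qf γ c P (V (π i)) s a) + (n i + 1) * KL p (π (i + 1) s)
      ≤ n i * KL p (π i s) + L := fun s p hp => by
    simpa only [mul_comm (Qf γ c P _ s _)] using (mirror_step_recursion (hn i) (hinit s)
      (hpol i s) (hpos i s) (hpol (i + 1) s) (hstep i s)).2.2 p hp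
  have hlook := value_le_lookahead_add hγ hP (hpol (i + 1)) (hV _ (hpol (i + 1)))
    (v := V (π i)) (r := L / n i ^ 2) (fun s => by
      have h1 := three s _ (hpol i s)
      rw [KL_self, ← hV _ (hpol i) s] at h1
      have h2 := KL_nonneg (hpol i s) (hpol (i + 1) s) (hpos (i + 1) s)
      rw [le_div_iff₀ (by positivity)]
      have h3 : 0 ≤ (n i + 1) * KL (π i s) (π (i + 1) s) := by positivity
      linarith) s
  have h1 := three s _ (hπstar s)
  have h2 := sum_mul_Qf_sub (γ := γ) (c := c) (P := P) (p := πstar) (V (π i)) (V πstar) s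
  rw [← hV _ hπstar s] at h2
  have h3 := mul_le_mul_of_nonneg_left hlook (sq_nonneg (n i))
  have h4 : n i ^ 2 * (γ * (L / n i ^ 2 / (1 - γ))) = L / (1 - γ) - L := by
    field_simp
    ring
  rw [hn1]
  linear_combination h1 + h3 + h4 + n i ^ 2 * h2

theorem one_le_sup_div {S A : Type*} [Fintype S] [Nonempty S] [Fintype A] [Nonempty A]
    {P : S → A → S → ℝ} {ν : S → ℝ} (hν : IsDist ν) (hνpos : ∀ s, 0 < ν s)
    (hP : ∀ s a, IsDist (P s a)) :
    1 ≤ univ.sup' univ_nonempty (fun x : S × A × S => P x.1 x.2.1 x.2.2 / ν x.2.2) := by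
  let s := Classical.arbitrary S
  let a := Classical.arbitrary A
  obtain ⟨t, -, ht⟩ := exists_le_of_sum_le (s := univ) (f := ν) (g := P s a) univ_nonempty
    (hν.2.trans (hP s a).2.symm).le
  exact ((one_le_div (hνpos t)).2 ht).trans
    (le_sup' (fun x : S × A × S => P x.1 x.2.1 x.2.2 / ν x.2.2) (mem_univ (s, a, t)))

theorem suboptMass_le_one {S A : Type*} [Fintype A] [Nonempty A] {Q p : S → A → ℝ}
    (hp : IsPolicy p) (s : S) : suboptMass Q p s ≤ 1 := by
  rw [← (hp s).2]
  exact sum_le_sum fun a _ => by split_ifs; exacts [(hp s).1 a, le_rfl]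

theorem suboptMass_le_card_mul {S A : Type*} [Fintype A] [Nonempty A] {Q p : S → A → ℝ} {s : S}
    {E : ℝ} (hE : 0 ≤ E) (h : ∀ a, Q s a ≠ Qmin Q s → p s a ≤ E) :
    suboptMass Q p s ≤ Fintype.card A * E := by
  rw [← nsmul_eq_mul, ← card_univ]
  exact sum_le_card_nsmul _ _ _ fun a _ => by split_ifs with ha; exacts [hE, h a ha]

/-- Weighted action gaps dominate the optimal gap up to the weighted value errors. -/
theorem gap_sum_le {S A ι : Type*} [Fintype S] {P : S → A → S → ℝ} {γ : ℝ} {c : S → A → ℝ}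
    (hγ : 0 ≤ γ) (hP : ∀ s a, IsDist (P s a)) {v : ι → S → ℝ} {w : S → ℝ}
    (hvw : ∀ i s, w s ≤ v i s) {n : ι → ℝ} (I : Finset ι) {s : S} {a b : A} {Δ : ℝ}
    (hΔ : Δ ≤ Qf γ c P w s a - Qf γ c P w s b) :
    Δ * ∑ i ∈ I, n i ^ 2 - γ * ∑ s', P s b s' * ∑ i ∈ I, n i ^ 2 * (v i s' - w s')
      ≤ ∑ i ∈ I, n i ^ 2 * (Qf γ c P (v i) s a - Qf γ c P (v i) s b) := by
  have hswap : ∑ s', P s b s' * ∑ i ∈ I, n i ^ 2 * (v i s' - w s')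
      = ∑ i ∈ I, n i ^ 2 * ∑ s', P s b s' * (v i s' - w s') := by
    simp only [mul_sum]
    rw [sum_comm]
    exact sum_congr rfl fun i _ => sum_congr rfl fun t _ => by ring
  rw [hswap, mul_sum, mul_sum, ← sum_sub_distrib]
  refine sum_le_sum fun i _ => ?_
  have ha : Qf γ c P w s a ≤ Qf γ c P (v i) s a :=
    add_le_add_right (mul_le_mul_of_nonneg_left
      (sum_le_sum fun t _ => mul_le_mul_of_nonneg_left (hvw i t) ((hP s a).1 t)) hγ) _
  have hb : Qf γ c P (v i) s b = Qf γ c P w s b + γ * ∑ s', P s b s' * (v i s' - w s') := by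
    simp only [Qf, mul_sub, sum_sub_distrib]
    ring
  have := mul_le_mul_of_nonneg_left
    (show Δ - γ * ∑ s', P s b s' * (v i s' - w s') ≤ Qf γ c P (v i) s a - Qf γ c P (v i) s b by
      linarith) (sq_nonneg (n i))
  linarith

end Convergence

/-- local accelerated convergence of sublinearly converging HPMD
(Theorem 7). -/
theorem stmt14 {S A : Type*} [Fintype S] [Nonempty S] [Fintype A] [Nonempty A]
    (γ : ℝ) (hγ : 0 < γ ∧ γ < 1)
    (C : ℝ) (c : S → A → ℝ) (hC : ∀ s a, |c s a| ≤ C)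
    (P : S → A → S → ℝ) (hP : ∀ s a, IsDist (P s a))
    (V : (S → A → ℝ) → S → ℝ)
    (hV : ∀ π, IsPolicy π → ∀ s, V π s = ∑ a, π s a * Qf γ c P (V π) s a)
    (πstar : S → A → ℝ) (hπstar : IsPolicy πstar)
    (hoptimal : ∀ π', IsPolicy π' → ∀ s, V πstar s ≤ V π' s)
    (ν : S → ℝ) (hν : IsDist ν) (hνpos : ∀ s, 0 < ν s)
    (hνstat : ∀ s', ν s' = ∑ s, ν s * ∑ a, πstar s a * P s a s')
    -- Q* = Q^{π*}
    (Qst : S → A → ℝ) (hQst : Qst = Qf γ c P (V πstar))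
    -- the distribution mismatch ratio ϱ
    (ϱ : ℝ)
    (hϱ : ϱ = γ * Finset.univ.sup' Finset.univ_nonempty
        (fun x : S × A × S => P x.1 x.2.1 x.2.2 / ν x.2.2))
    -- the gap value Δ*(M)
    (Δ : ℝ)
    (hΔlb : ∀ s a, Qst s a ≠ Qmin Qst s → Δ ≤ Qst s a - Qmin Qst s)
    (hΔmem : ∃ s a, Qst s a ≠ Qmin Qst s ∧ Δ = Qst s a - Qmin Qst s)
    -- HPMD parameters: η_k = k + k₀, τ_k = 1/(k+k₀)², with k₀ = ⌈γ/(1−γ)⌉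
    (k₀ : ℕ) (hk₀ : k₀ = ⌈γ / (1 - γ)⌉₊)
    (η τ : ℕ → ℝ)
    (hηdef : ∀ k, η k = (k : ℝ) + (k₀ : ℝ))
    (hτdef : ∀ k, τ k = 1 / ((k : ℝ) + (k₀ : ℝ))^2)
    -- HPMD iterates
    (π : ℕ → S → A → ℝ) (hpol : ∀ k, IsPolicy (π k))
    (hinit : ∀ s a, π 0 s a = 1 / (Fintype.card A : ℝ))
    (hstep : ∀ k s, ∀ p : A → ℝ, IsDist p →
      η k * ((∑ a, Qf γ c P (V (π k)) s a * π (k+1) s a) + τ k * KL (π (k+1) s) (π 0 s))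
          + KL (π (k+1) s) (π k s) ≤
      η k * ((∑ a, Qf γ c P (V (π k)) s a * p a) + τ k * KL p (π 0 s)) + KL p (π k s)) :
    ∀ k : ℕ,
      ((32 * ϱ * Real.log (Fintype.card A : ℝ) / (Δ * (1 - γ))) *
          Real.log (32 * ϱ * Real.log (Fintype.card A : ℝ) / (Δ * (1 - γ)))
        + 2 * (k₀ : ℝ)) ^ 3 ≤ (k : ℝ) →
      distL1 V (π (k+1)) ≤
        2 * Real.exp (C / (3 * (1 - γ))) * (Fintype.card A : ℝ) *
          Real.exp (-(Δ * (k : ℝ) ^ 2 / 16)) ∧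
      ∀ s, V (π (k+1)) s - V πstar s ≤
        (2 * C * (Fintype.card A : ℝ) * Real.exp (C / (3 * (1 - γ))) / (1 - γ) ^ 2) *
          Real.exp (-(Δ * (k : ℝ) ^ 2 / 16)) := by
  intro k hk
  set L := Real.log (Fintype.card A : ℝ) with hLdef
  set x := 32 * ϱ * L / (Δ * (1 - γ)) with hxdef
  have hδ : 0 < 1 - γ := by linarith [hγ.2]
  set d := 1 / (1 - γ) with hddef
  have hopt : IsOptPolicy V πstar := ⟨hπstar, hoptimal⟩
  have hdiv : ∀ y, y / (1 - γ) = y * d := fun y => by rw [hddef, mul_one_div]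
  have hδd : (1 - γ) * d = 1 := mul_one_div_cancel hδ.ne'
  have hd0 : 0 < d := by positivity
  have hγd : γ * d = d - 1 := by linarith
  have hd1 : 1 ≤ d := by linarith [mul_pos hγ.1 hd0]
  have hk₀1 : 1 ≤ k₀ := by
    rw [hk₀]
    exact Nat.one_le_ceil_iff.2 (div_pos hγ.1 hδ)
  have hdk₀ : d ≤ k₀ + 1 := by
    have := Nat.le_ceil (γ / (1 - γ))
    rw [← hk₀, hdiv] at this
    linarith
  have hC0 : 0 ≤ C :=
    (abs_nonneg _).trans (hC (Classical.arbitrary S) (Classical.arbitrary A))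
  have hΔ0 : 0 < Δ := by
    obtain ⟨s, a, hne, rfl⟩ := hΔmem
    exact sub_pos.2 (lt_of_le_of_ne (Qmin_le Qst s a) hne.symm)
  have hcard : 1 < Fintype.card A := by
    obtain ⟨s, a, hne, -⟩ := hΔmem
    obtain ⟨b, hb⟩ := exists_eq_Qmin Qst s
    exact Fintype.one_lt_card_iff.2 ⟨a, b, fun h => hne (h ▸ hb)⟩
  have hL0 : 0 < L := Real.log_pos (by exact_mod_cast hcard)
  have hϱγ : γ ≤ ϱ := by
    rw [hϱ]
    exact le_mul_of_one_le_right hγ.1.le (one_le_sup_div hν hνpos hP)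
  have hϱ0 : 0 < ϱ := hγ.1.trans_le hϱγ
  have hx0 : 0 < x := by positivity
  have hxΔ : x * Δ = 32 * ϱ * L * d := by
    rw [hxdef, hddef]
    field_simp
  set n : ℕ → ℝ := fun i => (i : ℝ) + k₀ with hndef
  have hn0 : n 0 = k₀ := by simp [hndef]
  have hn : ∀ i, 0 < n i := fun i => by simp only [hndef]; positivity
  have hn1 : ∀ i, n (i + 1) = n i + 1 := fun i => by simp only [hndef]; push_cast; ring
  simp only [hηdef, hτdef] at hstep
  have hpos := hpmd_pos (n := n) hn hpol hinit hstep
  have hVabs := fun p hp => abs_value_le hγ hP hp hC (hV p hp)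
  have hsum := sum_sq_mul_le (e := fun i s => V (π i) s - V πstar s)
    (D := fun i s => KL (πstar s) (π i s)) (n := n) (B := 2 * C * d) (L := L) (ρ := L * d)
    hγ hP hπstar (fun i s => sub_nonneg.2 (hoptimal _ (hpol i) s))
    (fun i s => KL_nonneg (hπstar s) (hpol i s) (hpos i s))
    (by rw [hn0]; exact_mod_cast hk₀1) hn1 (by positivity)
    (fun i s => by
      rw [← hdiv]
      exact hpmd_value_recursion hγ hP hV hπstar hn hn1 hpol hinit hstep i s)
    (fun s => by
      have h1 := (abs_le.1 (hVabs _ (hpol 0) s)).2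
      have h2 := (abs_le.1 (hVabs _ hπstar s)).1
      rw [hdiv] at h1 h2
      linarith)
    (fun s => KL_uniform_le (hπstar s) (hinit s)) k
  simp only [hdiv, hn0] at hsum
  set E := Real.exp (C / (3 * (1 - γ))) * Real.exp (-(Δ * (k : ℝ) ^ 2 / 16)) with hEdef
  have hE : E = Real.exp (C * d / 3 - Δ * (k : ℝ) ^ 2 / 16) := by
    rw [hEdef, ← Real.exp_add, ← hdiv, div_div, mul_comm (1 - γ) 3, ← sub_eq_add_neg]
  have hmass : ∀ s, suboptMass (Qf γ c P (V πstar)) (π (k + 1)) s ≤ Fintype.card A * E := by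
    intro s
    rw [← hQst]
    rcases le_total 1 E with h1E | hE1
    · refine (suboptMass_le_one (hpol (k + 1)) s).trans ?_
      have : (1 : ℝ) ≤ Fintype.card A := by exact_mod_cast hcard.le
      nlinarith
    refine suboptMass_le_card_mul (by rw [hE]; positivity) fun a ha => ?_
    have hCΔ : C * d / 3 ≤ Δ * (k : ℝ) ^ 2 / 16 := by
      rw [hE, Real.exp_le_one_iff] at hE1
      linarith
    obtain ⟨b, hb⟩ := exists_eq_Qmin Qst s
    have hgap := hΔlb s a ha
    have hX := (hP s b).sum_mul_le hsum
    have harith := exponent_arith (k := (k : ℝ)) hk₀1 hγ.1 hd1 hγd hdk₀ hC0 hL0.le hϱγ hΔ0 hx0 hxΔ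
      rfl (Nat.cast_nonneg k) hk hCΔ hX (sum_sq_range_add k₀ k)
    have hlog := hpmd_log_ratio (n := n) hn hn1 hpol hinit hstep (k + 1) s a b
    have hQ : Δ * ∑ i ∈ Finset.range (k + 1), n i ^ 2
        - γ * ∑ s', P s b s' * ∑ i ∈ Finset.range (k + 1), n i ^ 2 * (V (π i) s' - V πstar s')
        ≤ ∑ i ∈ Finset.range (k + 1),
          n i ^ 2 * (Qf γ c P (V (π i)) s a - Qf γ c P (V (π i)) s b) := by
      refine gap_sum_le hγ.1.le hP (fun i s => hoptimal _ (hpol i) s) _ ?_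
      rw [← hQst, hb]
      exact hgap
    have hN : n (k + 1) = (k : ℝ) + 1 + k₀ := by simp only [hndef]; push_cast; ring
    have hlogle : Real.log (π (k + 1) s a) - Real.log (π (k + 1) s b)
        ≤ C * d / 3 - Δ * (k : ℝ) ^ 2 / 16 := by
      refine le_of_mul_le_mul_left ?_ (hn (k + 1))
      rw [hlog, hN]
      linarith
    rw [hE, ← Real.log_le_iff_le_exp (hpos (k + 1) s a)]
    linarith [Real.log_nonpos (hpos (k + 1) s b).le ((hpol (k + 1) s).le_one b)]
  refine ⟨(distL1_le hγ hP hV hopt (hpol (k + 1)) hmass).trans_eq (by rw [hEdef]; ring),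
    fun s => (value_sub_le hγ hP hC hV hopt (hpol (k + 1)) hmass s).trans_eq
      (by rw [hEdef]; ring)⟩
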